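/- arXiv:2312.15417 — 2 statements merged into one kernel-verified Lean document; each statement's English description precedes it below -/
import Mathlib

section
/- Let A and B be standard rank-one ℂ[U]-modules. Then ord_U(A ⊗̃ B) ≤ max(ord_U(A), ord_U(B)). -/
open Polynomial TensorProduct

noncomputable section

/-- The action of `U` (i.e. multiplication by `X`) on a `ℂ[U]`-module,
as a `ℂ[U]`-linear endomorphism. -/
def Uact (M : Type) [AddCommGroup M] [Module (Polynomial ℂ) M] :
    M →ₗ[Polynomial ℂ] M :=
  LinearMap.lsmul (Polynomial ℂ) M Polynomial.X

section Tensor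

variable (A B : Type)
  [AddCommGroup A] [Module ℂ A] [Module (Polynomial ℂ) A] [IsScalarTower ℂ (Polynomial ℂ) A]
  [AddCommGroup B] [Module ℂ B] [Module (Polynomial ℂ) B] [IsScalarTower ℂ (Polynomial ℂ) B]

/-- `U₁ = (U•) ⊗ id` on `A ⊗[ℂ] B`, where `ℂ[U]` acts on `A ⊗[ℂ] B` through
the left factor. -/
def U₁ : A ⊗[ℂ] B →ₗ[Polynomial ℂ] A ⊗[ℂ] B :=
  TensorProduct.AlgebraTensorModule.map (Uact A) (LinearMap.id : B →ₗ[ℂ] B)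

/-- `U₂ = id ⊗ (U•)` on `A ⊗[ℂ] B`. -/
def U₂ : A ⊗[ℂ] B →ₗ[Polynomial ℂ] A ⊗[ℂ] B :=
  TensorProduct.AlgebraTensorModule.map (LinearMap.id : A →ₗ[Polynomial ℂ] A)
    ((Uact B).restrictScalars ℂ)

/-- `U₁ - U₂` as a `ℂ[U]`-linear endomorphism of `A ⊗[ℂ] B`. -/
def Udiff : A ⊗[ℂ] B →ₗ[Polynomial ℂ] A ⊗[ℂ] B := U₁ A B - U₂ A B

/-- `coker (U₁ - U₂)` as a `ℂ[U]`-module. -/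
abbrev CokerUdiff := (A ⊗[ℂ] B) ⧸ LinearMap.range (Udiff A B)

/-- `A ⊗̃ B = ker (U₁ - U₂) ⊕ coker (U₁ - U₂)` as a `ℂ[U]`-module. -/
abbrev TildeTensor := LinearMap.ker (Udiff A B) × CokerUdiff A B

end Tensor

/-- `ordSet M = {k | ∃ x ∈ M, U^k • x ≠ 0 ∧ U^(k+1) • x = 0}`. -/
def ordSet (M : Type) [AddCommGroup M] [Module (Polynomial ℂ) M] : Set ℕ :=
  {k | ∃ x : M, (Polynomial.X : Polynomial ℂ) ^ k • x ≠ 0 ∧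
    (Polynomial.X : Polynomial ℂ) ^ (k + 1) • x = 0}

/-- The torsion order `ord_U M = sSup (ordSet M)` (in `ℕ`, with `sSup ∅ = 0`). -/
def ordU (M : Type) [AddCommGroup M] [Module (Polynomial ℂ) M] : ℕ := sSup (ordSet M)

/-- A `ℂ[U]`-module is standard rank-one if it is finitely generated, its torsion
submodule is annihilated by a power of `U`, and the quotient by the torsion
submodule is isomorphic to `ℂ[U]`. -/
def StandardRankOne (M : Type) [AddCommGroup M] [Module (Polynomial ℂ) M] : Prop :=
  Module.Finite (Polynomial ℂ) M ∧
  (∃ n : ℕ, ∀ x ∈ Submodule.torsion (Polynomial ℂ) M, (Polynomial.X : Polynomial ℂ) ^ n • x = 0) ∧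
  Nonempty ((M ⧸ Submodule.torsion (Polynomial ℂ) M) ≃ₗ[Polynomial ℂ] Polynomial ℂ)

theorem X_pow_smul_eq_zero_of_le {M : Type} [AddCommGroup M] [Module (Polynomial ℂ) M]
    {m n : ℕ} (h : m ≤ n) {x : M} (hx : (Polynomial.X : Polynomial ℂ) ^ m • x = 0) :
    (Polynomial.X : Polynomial ℂ) ^ n • x = 0 := by
  obtain ⟨d, rfl⟩ := Nat.exists_eq_add_of_le' h
  rw [pow_add, mul_smul, hx, smul_zero]

/-- If every `U`-power torsion element of `M` is annihilated by `U ^ (m + 1)`,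
then `ordU M ≤ m`. -/
theorem ordU_le_of_forall {M : Type} [AddCommGroup M] [Module (Polynomial ℂ) M] {m : ℕ}
    (h : ∀ (k : ℕ) (x : M), (Polynomial.X : Polynomial ℂ) ^ k • x = 0 →
      (Polynomial.X : Polynomial ℂ) ^ (m + 1) • x = 0) : ordU M ≤ m := by
  refine csSup_le' ?_
  rintro k ⟨x, hx, hx'⟩
  by_contra! hk
  exact hx (X_pow_smul_eq_zero_of_le hk (h _ x hx'))

namespace StandardRankOne

variable {M : Type} [AddCommGroup M] [Module (Polynomial ℂ) M]

theorem bddAbove_ordSet (hM : StandardRankOne M) : BddAbove (ordSet M) := by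
  obtain ⟨-, ⟨n, hn⟩, -⟩ := hM
  refine ⟨n, ?_⟩
  rintro k ⟨x, hx, hx'⟩
  by_contra! hk
  refine hx (X_pow_smul_eq_zero_of_le hk.le (hn x ?_))
  exact (Submodule.mem_torsion_iff x).2
    ⟨⟨_, mem_nonZeroDivisors_of_ne_zero (pow_ne_zero (k + 1) Polynomial.X_ne_zero)⟩, hx'⟩

theorem X_pow_smul_eq_zero (hM : StandardRankOne M) {k : ℕ} {x : M}
    (hx : (Polynomial.X : Polynomial ℂ) ^ k • x = 0) :
    (Polynomial.X : Polynomial ℂ) ^ (ordU M + 1) • x = 0 := by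
  induction k with
  | zero => exact X_pow_smul_eq_zero_of_le (Nat.zero_le _) hx
  | succ k ih =>
    by_cases h : (Polynomial.X : Polynomial ℂ) ^ k • x = 0
    · exact ih h
    · exact X_pow_smul_eq_zero_of_le
        (Nat.succ_le_succ (le_csSup hM.bddAbove_ordSet ⟨x, h, hx⟩)) hx

theorem X_pow_smul_eq_zero_of_mem_torsion (hM : StandardRankOne M) {x : M}
    (hx : x ∈ Submodule.torsion (Polynomial ℂ) M) :
    (Polynomial.X : Polynomial ℂ) ^ (ordU M + 1) • x = 0 := by
  obtain ⟨n, hn⟩ := hM.2.1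
  exact hM.X_pow_smul_eq_zero (hn x hx)

/-- A standard rank-one module splits off a free summand spanned by some `x₀`, with complement
annihilated by `U ^ (ordU M + 1)`. -/
theorem exists_splitting (hM : StandardRankOne M) :
    ∃ (p : M →ₗ[Polynomial ℂ] Polynomial ℂ) (x₀ : M),
      ∀ x, (Polynomial.X : Polynomial ℂ) ^ (ordU M + 1) • (x - p x • x₀) = 0 := by
  obtain ⟨e⟩ := hM.2.2
  obtain ⟨x₀, hx₀⟩ := Submodule.Quotient.mk_surjective _ (e.symm 1)
  refine ⟨e.toLinearMap ∘ₗ Submodule.mkQ _, x₀, fun x => ?_⟩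
  refine hM.X_pow_smul_eq_zero_of_mem_torsion ?_
  rw [← Submodule.Quotient.mk_eq_zero, Submodule.Quotient.mk_sub, Submodule.Quotient.mk_smul,
    hx₀, ← map_smul]
  simp

end StandardRankOne

section TildeTensor

variable {A B : Type}
  [AddCommGroup A] [Module ℂ A] [Module (Polynomial ℂ) A] [IsScalarTower ℂ (Polynomial ℂ) A]
  [AddCommGroup B] [Module ℂ B] [Module (Polynomial ℂ) B] [IsScalarTower ℂ (Polynomial ℂ) B]

@[simp]
theorem Udiff_tmul (a : A) (b : B) :
    Udiff A B (a ⊗ₜ b) = ((Polynomial.X : Polynomial ℂ) • a) ⊗ₜ[ℂ] b -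
      a ⊗ₜ[ℂ] ((Polynomial.X : Polynomial ℂ) • b) := rfl

theorem Udiff_map {A' : Type} [AddCommGroup A'] [Module ℂ A'] [Module (Polynomial ℂ) A']
    [IsScalarTower ℂ (Polynomial ℂ) A'] (f : A →ₗ[Polynomial ℂ] A') (z : A ⊗[ℂ] B) :
    Udiff A' B (TensorProduct.AlgebraTensorModule.map f LinearMap.id z) =
      TensorProduct.AlgebraTensorModule.map f LinearMap.id (Udiff A B z) := by
  induction z with
  | zero => simp
  | tmul a b => simp
  | add x y hx hy => simp only [map_add, hx, hy]

/-- The coefficients of an element of `ℂ[U] ⊗ B`. -/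
def tensorCoeff : Polynomial ℂ ⊗[ℂ] B ≃ₗ[ℂ] (ℕ →₀ B) :=
  TensorProduct.equivFinsuppOfBasisLeft (Polynomial.basisMonomials ℂ)

omit [Module (Polynomial ℂ) B] [IsScalarTower ℂ (Polynomial ℂ) B] in
theorem tensorCoeff_tmul (p : Polynomial ℂ) (b : B) (k : ℕ) :
    tensorCoeff (p ⊗ₜ[ℂ] b) k = p.coeff k • b := by
  simp [tensorCoeff, Polynomial.basisMonomials, Polynomial.coeff]

theorem tensorCoeff_Udiff (w : Polynomial ℂ ⊗[ℂ] B) (k : ℕ) :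
    tensorCoeff (Udiff (Polynomial ℂ) B w) (k + 1) =
      tensorCoeff w k - (Polynomial.X : Polynomial ℂ) • tensorCoeff w (k + 1) := by
  induction w with
  | zero => simp
  | tmul p b =>
    simp only [Udiff_tmul, map_sub, Finsupp.sub_apply, tensorCoeff_tmul, smul_eq_mul,
      Polynomial.coeff_X_mul]
    rw [smul_comm]
  | add x y hx hy =>
    simp only [map_add, Finsupp.add_apply, hx, hy, smul_add]
    abel

theorem Udiff_polynomial_injective : Function.Injective (Udiff (Polynomial ℂ) B) := by
  rw [injective_iff_map_eq_zero]
  intro w hw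
  have hrec (k : ℕ) : tensorCoeff w k =
      (Polynomial.X : Polynomial ℂ) • tensorCoeff w (k + 1) := by
    have h := tensorCoeff_Udiff w k
    rw [hw, map_zero, Finsupp.zero_apply] at h
    exact sub_eq_zero.1 h.symm
  have hpow (k d : ℕ) : tensorCoeff w k =
      (Polynomial.X : Polynomial ℂ) ^ d • tensorCoeff w (k + d) := by
    induction d with
    | zero => simp
    | succ d ih => rw [ih, hrec, pow_succ, mul_smul, add_assoc]
  obtain ⟨N, hN⟩ := (tensorCoeff w).support.exists_nat_subset_range
  refine tensorCoeff.map_eq_zero_iff.1 (Finsupp.ext fun k => ?_)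
  rw [hpow k N, Finsupp.notMem_support_iff.1 fun h => ?_, smul_zero, Finsupp.zero_apply]
  have := Finset.mem_range.1 (hN h)
  omega

omit [Module (Polynomial ℂ) B] [IsScalarTower ℂ (Polynomial ℂ) B] in
/-- The endomorphism of `A ⊗ B` induced by `a ↦ p a • a₀` differs from the identity by a map
annihilated by every scalar annihilating all `a - p a • a₀`. -/
theorem smul_eq_smul_of_splitting {r : Polynomial ℂ} {p : A →ₗ[Polynomial ℂ] Polynomial ℂ}
    {a₀ : A} (h : ∀ a, r • (a - p a • a₀) = 0) (z : A ⊗[ℂ] B) :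
    r • z = r • TensorProduct.AlgebraTensorModule.map
      (LinearMap.toSpanSingleton (Polynomial ℂ) A a₀) LinearMap.id
        (TensorProduct.AlgebraTensorModule.map p (LinearMap.id : B →ₗ[ℂ] B) z) := by
  induction z with
  | zero => simp
  | tmul a b =>
    have := h a
    rw [smul_sub, sub_eq_zero] at this
    simp [TensorProduct.smul_tmul', this]
  | add x y hx hy => simp only [smul_add, map_add, ← hx, ← hy]

theorem StandardRankOne.X_pow_smul_ker_Udiff (hA : StandardRankOne A)
    (z : LinearMap.ker (Udiff A B)) :
    (Polynomial.X : Polynomial ℂ) ^ (ordU A + 1) • z = 0 := by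
  obtain ⟨p, a₀, h⟩ := hA.exists_splitting
  obtain ⟨z, hz⟩ := z
  have hpz : TensorProduct.AlgebraTensorModule.map p (LinearMap.id : B →ₗ[ℂ] B) z = 0 :=
    Udiff_polynomial_injective (by rw [Udiff_map, LinearMap.mem_ker.1 hz, map_zero, map_zero])
  refine Subtype.ext ?_
  change _ • z = 0
  rw [smul_eq_smul_of_splitting h, hpz, map_zero, smul_zero]

/-- The map `ℂ[U] ⊗ B → B` given by the action of `ℂ[U]` on `B`. -/
def actionMap : Polynomial ℂ ⊗[ℂ] B →ₗ[Polynomial ℂ] B :=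
  TensorProduct.AlgebraTensorModule.lift
    { toFun := fun q => (LinearMap.lsmul (Polynomial ℂ) B q).restrictScalars ℂ
      map_add' := fun q r => by ext; simp
      map_smul' := fun q r => by ext; simp [mul_smul] }

@[simp]
theorem actionMap_tmul (q : Polynomial ℂ) (b : B) : actionMap (q ⊗ₜ[ℂ] b) = q • b := rfl

theorem actionMap_Udiff (w : Polynomial ℂ ⊗[ℂ] B) :
    actionMap (Udiff (Polynomial ℂ) B w) = 0 := by
  induction w with
  | zero => simp
  | tmul q b => simp [← mul_smul, mul_comm]
  | add x y hx hy => simp only [map_add, hx, hy, add_zero]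

theorem smul_tmul_sub_tmul_smul_mem_range_Udiff (q : Polynomial ℂ) (a : A) (b : B) :
    (q • a) ⊗ₜ[ℂ] b - a ⊗ₜ[ℂ] (q • b) ∈ LinearMap.range (Udiff A B) := by
  induction q using Polynomial.induction_on' generalizing b with
  | add q r hq hr =>
    simp only [add_smul, TensorProduct.add_tmul, TensorProduct.tmul_add]
    rw [add_sub_add_comm]
    exact add_mem (hq b) (hr b)
  | monomial n c =>
    induction n generalizing b with
    | zero =>
      have hC (N : Type) [AddCommGroup N] [Module ℂ N] [Module (Polynomial ℂ) N]
          [IsScalarTower ℂ (Polynomial ℂ) N] (x : N) :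
          (Polynomial.monomial 0 c : Polynomial ℂ) • x = c • x := by
        rw [Polynomial.monomial_zero_left, ← Polynomial.algebraMap_eq, algebraMap_smul]
      rw [hC, hC, TensorProduct.smul_tmul, sub_self]
      exact zero_mem _
    | succ n ih =>
      have h₁ := ih ((Polynomial.X : Polynomial ℂ) • b)
      have h₂ : Udiff A B (((Polynomial.monomial n c : Polynomial ℂ) • a) ⊗ₜ b) ∈
        LinearMap.range (Udiff A B) := LinearMap.mem_range_self _ _
      rw [Udiff_tmul] at h₂
      have h₃ := add_mem h₂ h₁
      rw [sub_add_sub_cancel, ← mul_smul, ← mul_smul, Polynomial.X_mul_monomial,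
        Polynomial.monomial_mul_X] at h₃
      exact h₃

theorem map_toSpanSingleton_sub_mem_range_Udiff (a₀ : A) (w : Polynomial ℂ ⊗[ℂ] B) :
    TensorProduct.AlgebraTensorModule.map
      (LinearMap.toSpanSingleton (Polynomial ℂ) A a₀) LinearMap.id w -
        a₀ ⊗ₜ[ℂ] actionMap w ∈ LinearMap.range (Udiff A B) := by
  induction w with
  | zero => simp
  | tmul q b => simpa using smul_tmul_sub_tmul_smul_mem_range_Udiff q a₀ b
  | add x y hx hy =>
    simp only [map_add, TensorProduct.tmul_add]
    rw [add_sub_add_comm]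
    exact add_mem hx hy

theorem StandardRankOne.X_pow_smul_coker_Udiff (hA : StandardRankOne A)
    (hB : StandardRankOne B) {k : ℕ} {z : CokerUdiff A B}
    (hz : (Polynomial.X : Polynomial ℂ) ^ k • z = 0) :
    (Polynomial.X : Polynomial ℂ) ^ (max (ordU A) (ordU B) + 1) • z = 0 := by
  obtain ⟨p, a₀, h⟩ := hA.exists_splitting
  obtain ⟨z, rfl⟩ := Submodule.Quotient.mk_surjective _ z
  rw [← Submodule.Quotient.mk_smul, Submodule.Quotient.mk_eq_zero] at hz ⊢
  obtain ⟨y, hy⟩ := hz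
  set w := TensorProduct.AlgebraTensorModule.map p (LinearMap.id : B →ₗ[ℂ] B) z with hw
  have hk : (Polynomial.X : Polynomial ℂ) ^ k • actionMap w = 0 := by
    rw [hw, ← map_smul, ← map_smul, ← hy, ← Udiff_map, actionMap_Udiff]
  have hb : (Polynomial.X : Polynomial ℂ) ^ (max (ordU A) (ordU B) + 1) • actionMap w = 0 :=
    X_pow_smul_eq_zero_of_le (by omega) (hB.X_pow_smul_eq_zero hk)
  have hmem := map_toSpanSingleton_sub_mem_range_Udiff a₀
    ((Polynomial.X : Polynomial ℂ) ^ (max (ordU A) (ordU B) + 1) • w)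
  rw [map_smul, map_smul, hb, TensorProduct.tmul_zero, sub_zero] at hmem
  rwa [smul_eq_smul_of_splitting
    (fun a => X_pow_smul_eq_zero_of_le (Nat.succ_le_succ (le_max_left _ _)) (h a)) z]

end TildeTensor

variable (A B : Type)
  [AddCommGroup A] [Module ℂ A] [Module (Polynomial ℂ) A] [IsScalarTower ℂ (Polynomial ℂ) A]
  [AddCommGroup B] [Module ℂ B] [Module (Polynomial ℂ) B] [IsScalarTower ℂ (Polynomial ℂ) B]

/-- For standard rank-one `ℂ[U]`-modules `A` and `B`,
`ord_U (A ⊗̃ B) ≤ max (ord_U A) (ord_U B)`. -/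
theorem ordU_tildeTensor_le (hA : StandardRankOne A) (hB : StandardRankOne B) :
    ordU (TildeTensor A B) ≤ max (ordU A) (ordU B) := by
  refine ordU_le_of_forall fun k z hz => ?_
  obtain ⟨x, y⟩ := z
  refine Prod.ext ?_ ?_
  · exact X_pow_smul_eq_zero_of_le (Nat.succ_le_succ (le_max_left _ _))
      (hA.X_pow_smul_ker_Udiff x)
  · exact hA.X_pow_smul_coker_Udiff hB (congrArg Prod.snd hz)

end
end

section
/- Let a, b ≥ 1 be integers, and set A = ℂ[U]/(U^a) and B = ℂ[U]/(U^b). Then both ker(U₁ − U₂) and coker(U₁ − U₂), computed on A ⊗_ℂ B, are isomorphic as ℂ[U]-modules to ℂ[U]/(U^{min(a,b)}). -/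
open Polynomial TensorProduct

noncomputable section

section General

variable {A B : Type}
  [AddCommGroup A] [Module ℂ A] [Module (Polynomial ℂ) A] [IsScalarTower ℂ (Polynomial ℂ) A]
  [AddCommGroup B] [Module ℂ B] [Module (Polynomial ℂ) B] [IsScalarTower ℂ (Polynomial ℂ) B]

lemma Udiff_tmul_s8 (x : A) (y : B) :
    Udiff A B (x ⊗ₜ[ℂ] y) = ((X : ℂ[X]) • x) ⊗ₜ[ℂ] y - x ⊗ₜ[ℂ] ((X : ℂ[X]) • y) := rfl

lemma mk_tmul_smul (p : ℂ[X]) (x : A) (y : B) :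
    (Submodule.Quotient.mk (x ⊗ₜ[ℂ] (p • y)) : CokerUdiff A B) =
      Submodule.Quotient.mk ((p • x) ⊗ₜ[ℂ] y) := by
  induction p using Polynomial.induction_on' generalizing x y with
  | add p q hp hq =>
    simp only [add_smul, TensorProduct.tmul_add, TensorProduct.add_tmul,
      Submodule.Quotient.mk_add, hp, hq]
  | monomial n c =>
    induction n generalizing x y with
    | zero =>
      rw [monomial_zero_left, ← algebraMap_eq, algebraMap_smul, algebraMap_smul,
        TensorProduct.tmul_smul, TensorProduct.smul_tmul']
    | succ n ih =>
      rw [← monomial_mul_X, mul_smul, mul_smul, ih, ← smul_comm]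
      symm
      rw [Submodule.Quotient.eq]
      exact ⟨(monomial n c • x) ⊗ₜ[ℂ] y, Udiff_tmul_s8 _ _⟩

/-- Contraction of the right factor of `A ⊗[ℂ] B` against a functional on `B`. -/
def contractFunctional (A : Type) {B : Type}
    [AddCommGroup A] [Module ℂ A] [Module (Polynomial ℂ) A] [IsScalarTower ℂ (Polynomial ℂ) A]
    [AddCommGroup B] [Module ℂ B] (f : B →ₗ[ℂ] ℂ) : A ⊗[ℂ] B →ₗ[ℂ[X]] A :=
  TensorProduct.AlgebraTensorModule.rid ℂ ℂ[X] A ∘ₗ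
    TensorProduct.AlgebraTensorModule.map (LinearMap.id : A →ₗ[ℂ[X]] A) f

omit [Module ℂ[X] B] [IsScalarTower ℂ ℂ[X] B] in
lemma contractFunctional_tmul (f : B →ₗ[ℂ] ℂ) (x : A) (y : B) :
    contractFunctional A f (x ⊗ₜ[ℂ] y) = f y • x := by
  simp [contractFunctional]

lemma U₂_pow_tmul (k : ℕ) (x : A) (y : B) :
    (U₂ A B ^ k) (x ⊗ₜ[ℂ] y) = x ⊗ₜ[ℂ] ((X : ℂ[X]) ^ k • y) := by
  induction k generalizing y with
  | zero => simp
  | succ k ih =>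
    rw [pow_succ, Module.End.mul_apply, pow_succ, mul_smul, ← ih]
    rfl

omit [Module ℂ[X] B] [IsScalarTower ℂ ℂ[X] B] in
lemma U₁_apply (t : A ⊗[ℂ] B) : U₁ A B t = (X : ℂ[X]) • t := by
  induction t with
  | zero => simp
  | add s t hs ht => rw [map_add, hs, ht, smul_add]
  | tmul x y => rfl

lemma U₂_pow_apply_of_mem_ker {t : A ⊗[ℂ] B} (ht : t ∈ LinearMap.ker (Udiff A B)) (k : ℕ) :
    (U₂ A B ^ k) t = (X : ℂ[X]) ^ k • t := by
  have h : U₂ A B t = (X : ℂ[X]) • t := by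
    rw [← U₁_apply]
    exact (sub_eq_zero.mp (LinearMap.mem_ker.mp ht)).symm
  induction k with
  | zero => simp
  | succ k ih => rw [pow_succ, Module.End.mul_apply, h, map_smul, ih, smul_smul, pow_succ']

/-- The element `∑ Uᵏ x ⊗ U^(n-1-k) e` of `A ⊗[ℂ] B`, as a function of `x`. -/
def diagonalSum (A : Type) {B : Type}
    [AddCommGroup A] [Module ℂ A] [Module (Polynomial ℂ) A] [IsScalarTower ℂ (Polynomial ℂ) A]
    [AddCommGroup B] [Module ℂ B] [Module (Polynomial ℂ) B]
    (n : ℕ) (e : B) (x : A) : A ⊗[ℂ] B :=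
  ∑ k ∈ Finset.range n, ((X : ℂ[X]) ^ k • x) ⊗ₜ[ℂ] ((X : ℂ[X]) ^ (n - 1 - k) • e)

lemma Udiff_diagonalSum (n : ℕ) (e : B) (x : A) :
    Udiff A B (diagonalSum A n e x) =
      ((X : ℂ[X]) ^ n • x) ⊗ₜ[ℂ] e - x ⊗ₜ[ℂ] ((X : ℂ[X]) ^ n • e) := by
  have h := Finset.sum_range_sub
    (fun k => ((X : ℂ[X]) ^ k • x) ⊗ₜ[ℂ] ((X : ℂ[X]) ^ (n - k) • e)) n
  simp only [Nat.sub_self, pow_zero, one_smul, Nat.sub_zero] at h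
  rw [← h, diagonalSum, map_sum]
  refine Finset.sum_congr rfl fun k hk => ?_
  have hk := Finset.mem_range.mp hk
  rw [Udiff_tmul_s8, smul_smul, smul_smul, ← pow_succ', ← pow_succ',
    show n - 1 - k + 1 = n - k by omega, show n - 1 - k = n - (k + 1) by omega]

lemma diagonalSum_contractFunctional {n : ℕ} {e : B} {f : B →ₗ[ℂ] ℂ}
    (hf : ∀ y, ∑ k ∈ Finset.range n,
      f ((X : ℂ[X]) ^ k • y) • (X : ℂ[X]) ^ (n - 1 - k) • e = y)
    {t : A ⊗[ℂ] B} (ht : t ∈ LinearMap.ker (Udiff A B)) :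
    diagonalSum A n e (contractFunctional A f t) = t := by
  have key (s : A ⊗[ℂ] B) : ∑ k ∈ Finset.range n,
      contractFunctional A f ((U₂ A B ^ k) s) ⊗ₜ[ℂ] ((X : ℂ[X]) ^ (n - 1 - k) • e) = s := by
    induction s with
    | zero => simp
    | add s t hs ht =>
      simp only [map_add, TensorProduct.add_tmul, Finset.sum_add_distrib, hs, ht]
    | tmul x y =>
      conv_rhs => rw [← hf y]
      simp only [U₂_pow_tmul, contractFunctional_tmul, TensorProduct.tmul_sum,
        TensorProduct.smul_tmul]
  conv_rhs => rw [← key t]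
  simp only [diagonalSum, U₂_pow_apply_of_mem_ker ht, map_smul]

omit [IsScalarTower ℂ ℂ[X] B] in
lemma contractFunctional_diagonalSum {n : ℕ} (hn : 1 ≤ n) {e : B} {f : B →ₗ[ℂ] ℂ}
    (hf : ∀ k < n, f ((X : ℂ[X]) ^ k • e) = if k = n - 1 then 1 else 0) (x : A) :
    contractFunctional A f (diagonalSum A n e x) = x := by
  rw [diagonalSum, map_sum, Finset.sum_eq_single 0]
  · simp [contractFunctional_tmul, hf (n - 1) (by omega)]
  · intro k hk hk0
    have hk := Finset.mem_range.mp hk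
    rw [contractFunctional_tmul, hf _ (by omega), if_neg (by omega), zero_smul]
  · simp; omega

/-- If `B` is cyclic of length `n` with generator `e` and top-coefficient functional `f`, then
`ker (U₁ - U₂)` on `A ⊗[ℂ] B` is the `Uⁿ`-torsion of `A`. -/
def kerUdiffEquiv {n : ℕ} (hn : 1 ≤ n) {e : B} {f : B →ₗ[ℂ] ℂ}
    (hB : ∀ y : B, (X : ℂ[X]) ^ n • y = 0)
    (hf : ∀ y, ∑ k ∈ Finset.range n,
      f ((X : ℂ[X]) ^ k • y) • (X : ℂ[X]) ^ (n - 1 - k) • e = y)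
    (hfe : ∀ k < n, f ((X : ℂ[X]) ^ k • e) = if k = n - 1 then 1 else 0) :
    LinearMap.ker (Udiff A B) ≃ₗ[ℂ[X]] LinearMap.ker (LinearMap.lsmul ℂ[X] A (X ^ n)) where
  toLinearMap := ((contractFunctional A f).domRestrict _).codRestrict _ fun t => by
    rw [LinearMap.mem_ker, LinearMap.lsmul_apply, LinearMap.domRestrict_apply, ← map_smul,
      ← U₂_pow_apply_of_mem_ker t.2]
    have h (s : A ⊗[ℂ] B) : (U₂ A B ^ n) s = 0 := by
      induction s with
      | zero => simp
      | add s t hs ht => rw [map_add, hs, ht, add_zero]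
      | tmul x y => rw [U₂_pow_tmul, hB, TensorProduct.tmul_zero]
    rw [h, map_zero]
  invFun x := ⟨diagonalSum A n e x, by
    have hx : (X : ℂ[X]) ^ n • (x : A) = 0 := x.2
    rw [LinearMap.mem_ker, Udiff_diagonalSum, hx, hB, TensorProduct.zero_tmul,
      TensorProduct.tmul_zero, sub_zero]⟩
  left_inv t := Subtype.ext (diagonalSum_contractFunctional hf t.2)
  right_inv x := Subtype.ext (contractFunctional_diagonalSum hn hfe (x : A))

end General

/-- The coefficient of `Uⁿ⁻¹`, as a functional on `ℂ[U]/(Uⁿ)`. -/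
def topCoeff {n : ℕ} (hn : 1 ≤ n) : (ℂ[X] ⧸ Ideal.span {(X : ℂ[X]) ^ n}) →ₗ[ℂ] ℂ :=
  Submodule.liftQ ((Ideal.span {(X : ℂ[X]) ^ n}).restrictScalars ℂ) (lcoeff ℂ (n - 1)) (by
    intro p hp
    obtain ⟨q, rfl⟩ := Ideal.mem_span_singleton.mp ((Submodule.restrictScalars_mem ..).mp hp)
    rw [LinearMap.mem_ker, lcoeff_apply, coeff_X_pow_mul', if_neg (by omega)]) ∘ₗ
  (Submodule.Quotient.restrictScalarsEquiv ℂ (Ideal.span {(X : ℂ[X]) ^ n})).symm.toLinearMap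

lemma topCoeff_mk {n : ℕ} (hn : 1 ≤ n) (p : ℂ[X]) :
    topCoeff hn (Submodule.Quotient.mk p) = p.coeff (n - 1) := rfl

lemma X_pow_smul_quotient_eq_zero (n : ℕ) (y : ℂ[X] ⧸ Ideal.span {(X : ℂ[X]) ^ n}) :
    (X : ℂ[X]) ^ n • y = 0 := by
  obtain ⟨p, rfl⟩ := Submodule.Quotient.mk_surjective _ y
  rw [← Submodule.Quotient.mk_smul, Submodule.Quotient.mk_eq_zero, smul_eq_mul]
  exact Ideal.mul_mem_right _ _ (Ideal.mem_span_singleton_self _)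

lemma sum_topCoeff_smul {n : ℕ} (hn : 1 ≤ n) (y : ℂ[X] ⧸ Ideal.span {(X : ℂ[X]) ^ n}) :
    ∑ k ∈ Finset.range n, topCoeff hn ((X : ℂ[X]) ^ k • y) •
      (X : ℂ[X]) ^ (n - 1 - k) • (Submodule.Quotient.mk 1 : ℂ[X] ⧸ Ideal.span {(X : ℂ[X]) ^ n})
      = y := by
  obtain ⟨p, rfl⟩ := Submodule.Quotient.mk_surjective _ y
  simp only [← Submodule.Quotient.mk_smul, topCoeff_mk, smul_eq_mul, mul_one]
  rw [← Finset.sum_range_reflect]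
  have h : ∑ k ∈ Finset.range n, ((X : ℂ[X]) ^ (n - 1 - k) * p).coeff (n - 1) •
      (X : ℂ[X]) ^ (n - 1 - (n - 1 - k)) = ∑ k ∈ Finset.range n, C (p.coeff k) * X ^ k := by
    refine Finset.sum_congr rfl fun k hk => ?_
    have hk := Finset.mem_range.mp hk
    rw [coeff_X_pow_mul', if_pos (by omega), show n - 1 - (n - 1 - k) = k by omega,
      smul_eq_C_mul]
  refine (map_sum (Submodule.mkQ (Ideal.span {(X : ℂ[X]) ^ n})) _ _).symm.trans ?_
  rw [h, Submodule.mkQ_apply, Submodule.Quotient.eq, Ideal.mem_span_singleton, X_pow_dvd_iff]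
  intro d hd
  simp [coeff_X_pow, hd]

lemma topCoeff_X_pow {n : ℕ} (hn : 1 ≤ n) (k : ℕ) :
    topCoeff hn ((X : ℂ[X]) ^ k • Submodule.Quotient.mk 1) = if k = n - 1 then 1 else 0 := by
  rw [← Submodule.Quotient.mk_smul, topCoeff_mk, smul_eq_mul, mul_one, coeff_X_pow]
  simp only [eq_comm]

/-- The `Uᵇ`-torsion of `ℂ[U]/(Uᵃ)` is cyclic of length `min a b`. -/
lemma nonempty_ker_X_pow_equiv (a b : ℕ) :
    Nonempty (LinearMap.ker (LinearMap.lsmul ℂ[X] (ℂ[X] ⧸ Ideal.span {(X : ℂ[X]) ^ a}) (X ^ b))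
      ≃ₗ[ℂ[X]] (ℂ[X] ⧸ Ideal.span {(X : ℂ[X]) ^ min a b})) := by
  let g : ℂ[X] →ₗ[ℂ[X]] ℂ[X] ⧸ Ideal.span {(X : ℂ[X]) ^ a} :=
    Submodule.mkQ _ ∘ₗ LinearMap.lsmul ℂ[X] ℂ[X] (X ^ (a - min a b))
  have hg (p : ℂ[X]) : g p = Submodule.Quotient.mk (X ^ (a - min a b) * p) := rfl
  have hker : LinearMap.ker g = Ideal.span {(X : ℂ[X]) ^ min a b} := by
    ext p
    rw [LinearMap.mem_ker, hg, Submodule.Quotient.mk_eq_zero, Ideal.mem_span_singleton,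
      Ideal.mem_span_singleton]
    conv_lhs => rw [show (X : ℂ[X]) ^ a = X ^ (a - min a b) * X ^ min a b by
      rw [← pow_add]; congr 1; omega]
    exact mul_dvd_mul_iff_left (pow_ne_zero _ X_ne_zero)
  have hrange : LinearMap.range g =
      LinearMap.ker (LinearMap.lsmul ℂ[X] (ℂ[X] ⧸ Ideal.span {(X : ℂ[X]) ^ a}) (X ^ b)) := by
    ext y
    rw [LinearMap.mem_ker, LinearMap.lsmul_apply]
    constructor
    · rintro ⟨p, rfl⟩
      rw [hg, ← Submodule.Quotient.mk_smul, Submodule.Quotient.mk_eq_zero,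
        Ideal.mem_span_singleton, smul_eq_mul, ← mul_assoc, ← pow_add]
      exact Dvd.dvd.mul_right (pow_dvd_pow _ (by omega)) _
    · obtain ⟨p, rfl⟩ := Submodule.Quotient.mk_surjective _ y
      intro h
      rw [← Submodule.Quotient.mk_smul, Submodule.Quotient.mk_eq_zero,
        Ideal.mem_span_singleton, smul_eq_mul] at h
      have hp : (X : ℂ[X]) ^ (a - min a b) ∣ p := by
        rw [X_pow_dvd_iff] at h ⊢
        intro d hd
        simpa [coeff_X_pow_mul'] using h (d + b) (by omega)
      obtain ⟨q, rfl⟩ := hp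
      exact ⟨q, hg q⟩
  exact ⟨(LinearEquiv.ofEq _ _ hrange.symm).trans
    (g.quotKerEquivRange.symm.trans (Submodule.quotEquivOfEq _ _ hker))⟩

lemma nonempty_cokerUdiff_equiv (a b : ℕ) :
    Nonempty (CokerUdiff (ℂ[X] ⧸ Ideal.span {(X : ℂ[X]) ^ a}) (ℂ[X] ⧸ Ideal.span {(X : ℂ[X]) ^ b})
      ≃ₗ[ℂ[X]] (ℂ[X] ⧸ Ideal.span {(X : ℂ[X]) ^ min a b})) := by
  let A := ℂ[X] ⧸ Ideal.span {(X : ℂ[X]) ^ a}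
  let B := ℂ[X] ⧸ Ideal.span {(X : ℂ[X]) ^ b}
  let I := Ideal.span {(X : ℂ[X]) ^ min a b}
  have hle {c : ℕ} (hc : min a b ≤ c) : Ideal.span {(X : ℂ[X]) ^ c} ≤ I :=
    Ideal.span_singleton_le_span_singleton.mpr (pow_dvd_pow _ hc)
  let φ : A ⊗[ℂ] B →ₗ[ℂ[X]] ℂ[X] ⧸ I :=
    (Algebra.TensorProduct.lift (Ideal.Quotient.factorₐ ℂ[X] (hle (min_le_left a b)))
      (Ideal.Quotient.factorₐ ℂ (hle (min_le_right a b))) fun _ _ => mul_comm _ _).toLinearMap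
  have hφ (p q : ℂ[X]) : φ ((Submodule.Quotient.mk p : A) ⊗ₜ[ℂ] (Submodule.Quotient.mk q : B)) =
      Submodule.Quotient.mk (p * q) := rfl
  have hφU : LinearMap.range (Udiff A B) ≤ LinearMap.ker φ := by
    rintro _ ⟨t, rfl⟩
    rw [LinearMap.mem_ker]
    induction t with
    | zero => simp
    | add s t hs ht => rw [map_add, map_add, hs, ht, add_zero]
    | tmul x y =>
      obtain ⟨p, rfl⟩ := Submodule.Quotient.mk_surjective _ x
      obtain ⟨q, rfl⟩ := Submodule.Quotient.mk_surjective _ y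
      rw [Udiff_tmul_s8, map_sub, ← Submodule.Quotient.mk_smul, ← Submodule.Quotient.mk_smul, hφ, hφ,
        smul_mul_assoc, mul_smul_comm, sub_self]
  let ψ : ℂ[X] →ₗ[ℂ[X]] CokerUdiff A B := LinearMap.toSpanSingleton ℂ[X] _
    (Submodule.Quotient.mk ((Submodule.Quotient.mk 1 : A) ⊗ₜ[ℂ] (Submodule.Quotient.mk 1 : B)))
  have hψ (p : ℂ[X]) : ψ p = Submodule.Quotient.mk
      ((p • Submodule.Quotient.mk 1 : A) ⊗ₜ[ℂ] (Submodule.Quotient.mk 1 : B)) := rfl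
  have hmk {c : ℕ} (p : ℂ[X]) : (Submodule.Quotient.mk p : ℂ[X] ⧸ Ideal.span {(X : ℂ[X]) ^ c}) =
      p • Submodule.Quotient.mk 1 := by
    rw [← Submodule.Quotient.mk_smul, smul_eq_mul, mul_one]
  have hsurj : Function.Surjective ψ := by
    intro z
    obtain ⟨t, rfl⟩ := Submodule.Quotient.mk_surjective _ z
    induction t with
    | zero => exact ⟨0, map_zero _⟩
    | add s t hs ht =>
      obtain ⟨p, hp⟩ := hs
      obtain ⟨q, hq⟩ := ht
      exact ⟨p + q, by rw [map_add, hp, hq, Submodule.Quotient.mk_add]⟩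
    | tmul x y =>
      obtain ⟨p, rfl⟩ := Submodule.Quotient.mk_surjective _ x
      obtain ⟨q, rfl⟩ := Submodule.Quotient.mk_surjective _ y
      exact ⟨q * p, by rw [hψ, hmk q, mk_tmul_smul, hmk p, mul_smul]⟩
  have hker : LinearMap.ker ψ = I := by
    apply le_antisymm
    · intro p hp
      have h : Submodule.liftQ _ φ hφU (ψ p) = 0 := by rw [LinearMap.mem_ker.mp hp, map_zero]
      rw [hψ, Submodule.liftQ_apply, ← hmk p, hφ, mul_one] at h
      exact (Submodule.Quotient.mk_eq_zero _).mp h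
    · refine (Ideal.span_singleton_le_iff_mem _).mpr ?_
      rw [LinearMap.mem_ker, hψ]
      rcases min_choice a b with h | h <;> rw [h]
      · rw [X_pow_smul_quotient_eq_zero, TensorProduct.zero_tmul, Submodule.Quotient.mk_zero]
      · rw [← mk_tmul_smul, X_pow_smul_quotient_eq_zero, TensorProduct.tmul_zero,
          Submodule.Quotient.mk_zero]
  exact ⟨(ψ.quotKerEquivOfSurjective hsurj).symm.trans (Submodule.quotEquivOfEq _ _ hker)⟩

/-- For `A = ℂ[U]/(U^a)` and `B = ℂ[U]/(U^b)` with `a, b ≥ 1`, both `ker (U₁ - U₂)` and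
`coker (U₁ - U₂)` on `A ⊗[ℂ] B` are isomorphic to `ℂ[U]/(U^(min a b))` as `ℂ[U]`-modules. -/
theorem ker_coker_Udiff_of_cyclic (a b : ℕ) (ha : 1 ≤ a) (hb : 1 ≤ b) :
    Nonempty ((LinearMap.ker (Udiff
        (Polynomial ℂ ⧸ Ideal.span {(Polynomial.X : Polynomial ℂ) ^ a})
        (Polynomial ℂ ⧸ Ideal.span {(Polynomial.X : Polynomial ℂ) ^ b}))) ≃ₗ[Polynomial ℂ]
      (Polynomial ℂ ⧸ Ideal.span {(Polynomial.X : Polynomial ℂ) ^ (min a b)})) ∧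
    Nonempty ((CokerUdiff
        (Polynomial ℂ ⧸ Ideal.span {(Polynomial.X : Polynomial ℂ) ^ a})
        (Polynomial ℂ ⧸ Ideal.span {(Polynomial.X : Polynomial ℂ) ^ b})) ≃ₗ[Polynomial ℂ]
      (Polynomial ℂ ⧸ Ideal.span {(Polynomial.X : Polynomial ℂ) ^ (min a b)})) := by
  obtain ⟨e⟩ := nonempty_ker_X_pow_equiv a b
  exact ⟨⟨(kerUdiffEquiv hb (X_pow_smul_quotient_eq_zero b) (sum_topCoeff_smul hb)
    fun k _ => topCoeff_X_pow hb k).trans e⟩, nonempty_cokerUdiff_equiv a b⟩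

end
end
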